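/- arXiv:0906.0659 — 2 statements merged into one kernel-verified Lean document; each statement's English description precedes it below -/
import Mathlib

section
/- Let φ be a Jacob's ladder on [T₀,∞) and suppose there are constants 0 < k₁ ≤ k₂ with k₁T ≤ φ(T) ≤ k₂T for all T ≥ T₀. Then, as T → ∞, uniformly for all U > 0 with φ(T+U) − φ(T) ≤ φ(T), one has ∫_T^{T+U} Z(t)² dt = (1/2)[φ(T+U) − φ(T)]·(ln(φ(T)/2) − a) + O([φ(T+U) − φ(T)]²/T) + O((ln T)/T), where a = ln(2π) − 1 − c. -/
open Real MeasureTheory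

/-- `Z(t)²`, i.e. `|ζ(1/2 + it)|²`. -/
noncomputable def Z2 (t : ℝ) : ℝ := ‖riemannZeta (1/2 + Complex.I * t)‖ ^ 2

/-- The constant `a = ln(2π) − 1 − c`, where `c` is the Euler–Mascheroni constant. -/
noncomputable def aConst : ℝ := Real.log (2 * Real.pi) - 1 - Real.eulerMascheroniConstant

theorem continuous_Z2 : Continuous Z2 := by
  rw [continuous_iff_continuousAt]
  intro t
  have hs : (1 / 2 + Complex.I * t : ℂ) ≠ 1 := by
    intro h
    have := congrArg Complex.re h
    norm_num at this
  have hline : ContinuousAt (fun u : ℝ => (1 / 2 + Complex.I * u : ℂ)) t := by fun_prop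
  have hzeta : ContinuousAt riemannZeta (1 / 2 + Complex.I * t) :=
    (differentiableAt_riemannZeta hs).continuousAt
  exact (ContinuousAt.comp (f := fun u : ℝ => (1 / 2 + Complex.I * u : ℂ)) hzeta hline).norm.pow 2

/-- The first-order Taylor remainder of `x ↦ x * log x` is bounded by `(y - x) ^ 2 / x`. -/
theorem abs_mul_log_taylor_le {x y : ℝ} (hx : 0 < x) (hy : 0 < y) :
    |y * log y - x * log x - (y - x) * (log x + 1)| ≤ (y - x) ^ 2 / x := by
  have hrem : y * log y - x * log x - (y - x) * (log x + 1) = y * log (y / x) - (y - x) := by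
    rw [log_div hy.ne' hx.ne']
    ring
  have hupper : y * log (y / x) ≤ y * (y / x - 1) :=
    mul_le_mul_of_nonneg_left (log_le_sub_one_of_pos (by positivity)) hy.le
  have hlower : y * (1 - (y / x)⁻¹) ≤ y * log (y / x) :=
    mul_le_mul_of_nonneg_left (one_sub_inv_le_log_of_pos (by positivity)) hy.le
  have hupper_eq : y * (y / x - 1) = (y - x) ^ 2 / x + (y - x) := by
    field_simp
    ring
  have hlower_eq : y * (1 - (y / x)⁻¹) = y - x := by
    field_simp
  rw [hrem, abs_of_nonneg (by linarith)]
  linarith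

theorem short_parts_basic_formula
    (φ : ℝ → ℝ) (T₀ : ℝ)
    (hcont : ContinuousOn φ (Set.Ici T₀))
    (hmono : StrictMonoOn φ (Set.Ici T₀))
    (hpos : ∀ T ≥ T₀, 0 < φ T)
    (hladder : ∃ c₀ C : ℝ, ∀ T ≥ T₀,
      |(∫ t in (0:ℝ)..T, Z2 t) - (φ T / 2) * Real.log (φ T / 2)
        - (Real.eulerMascheroniConstant - Real.log (2 * Real.pi)) * (φ T / 2) - c₀|
        ≤ C * Real.log T / T)
    (k₁ k₂ : ℝ) (hk₁ : 0 < k₁) (hk₁₂ : k₁ ≤ k₂)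
    (hgrowth : ∀ T ≥ T₀, k₁ * T ≤ φ T ∧ φ T ≤ k₂ * T) :
    ∃ C' T₁ : ℝ, ∀ T ≥ T₁, ∀ U > (0:ℝ), φ (T + U) - φ T ≤ φ T →
      |(∫ t in T..(T + U), Z2 t)
        - (1/2) * (φ (T + U) - φ T) * (Real.log (φ T / 2) - aConst)|
        ≤ C' * ((φ (T + U) - φ T) ^ 2 / T + Real.log T / T) := by
  obtain ⟨c₀, C, hC⟩ := hladder
  refine ⟨2 * |C| + 1 / (2 * k₁), max T₀ (exp 1), fun T hT U hU _ => ?_⟩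
  have hT₀ : T ≥ T₀ := le_trans (le_max_left _ _) hT
  have hTe : exp 1 ≤ T := le_trans (le_max_right _ _) hT
  have hTpos : 0 < T := (exp_pos 1).trans_le hTe
  have hTU₀ : T + U ≥ T₀ := by linarith
  have hlog : 0 ≤ log T / T :=
    div_nonneg (log_nonneg (by linarith [add_one_le_exp (1 : ℝ)])) hTpos.le
  have hanti : log (T + U) / (T + U) ≤ log T / T :=
    log_div_self_antitoneOn hTe (show exp 1 ≤ T + U by linarith) (by linarith)
  have hx := hpos T hT₀
  have hy := hpos (T + U) hTU₀
  have hbound : ∀ r ≤ log T / T, 0 ≤ r → C * r ≤ |C| * (log T / T) := fun r hr hr₀ =>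
    (mul_le_mul_of_nonneg_right (le_abs_self C) hr₀).trans
      (mul_le_mul_of_nonneg_left hr (abs_nonneg C))
  have hlogU : 0 ≤ log (T + U) / (T + U) :=
    div_nonneg (log_nonneg (by linarith [add_one_le_exp (1 : ℝ)])) (by linarith)
  have hladderT := hC T hT₀
  have hladderTU := hC (T + U) hTU₀
  rw [mul_div_assoc] at hladderT hladderTU
  replace hladderT := hladderT.trans (hbound _ le_rfl hlog)
  replace hladderTU := hladderTU.trans (hbound _ hanti hlogU)
  have htaylor := abs_mul_log_taylor_le (half_pos hx) (half_pos hy)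
  have hquad : (φ (T + U) / 2 - φ T / 2) ^ 2 / (φ T / 2)
      ≤ 1 / (2 * k₁) * ((φ (T + U) - φ T) ^ 2 / T) := by
    have hk : 0 < k₁ * T := by positivity
    calc (φ (T + U) / 2 - φ T / 2) ^ 2 / (φ T / 2)
        = (φ (T + U) - φ T) ^ 2 / 2 / φ T := by field_simp
      _ ≤ (φ (T + U) - φ T) ^ 2 / 2 / (k₁ * T) :=
          div_le_div_of_nonneg_left (by positivity) hk (hgrowth T hT₀).1
      _ = _ := by field_simp
  have hint : (∫ t in T..(T + U), Z2 t)
      = (∫ t in (0:ℝ)..(T + U), Z2 t) - ∫ t in (0:ℝ)..T, Z2 t :=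
    (intervalIntegral.integral_interval_sub_left
      (continuous_Z2.intervalIntegrable _ _) (continuous_Z2.intervalIntegrable _ _)).symm
  have hcross₁ : 0 ≤ |C| * ((φ (T + U) - φ T) ^ 2 / T) := by positivity
  have hcross₂ : 0 ≤ 1 / (2 * k₁) * (log T / T) := mul_nonneg (by positivity) hlog
  rw [hint, aConst]
  rw [abs_le] at hladderT hladderTU htaylor ⊢
  constructor <;> linarith [hladderT.1, hladderT.2, hladderTU.1, hladderTU.2, htaylor.1, htaylor.2]
end

section
/- Let φ be a Jacob's ladder on [T₀,∞) with k₁T ≤ φ(T) ≤ k₂T for all T ≥ T₀ (for some constants 0 < k₁ ≤ k₂), and assume the Balasubramanian formula: for every ε > 0, ∫₀^T Z(t)² dt = T ln T + (2c − 1 − ln 2π)T + O(T^{1/3+ε}) as T → ∞. Fix ε > 0 and set U₀ = T^{1/3+2ε}. Then there is a constant C(ε) such that for all sufficiently large T and all 0 < U ≤ U₀, φ(T+U) − φ(T) ≤ φ(T+U₀) − φ(T) ≤ C(ε)·T^{1/3+2ε}. -/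
/-- The graph of `x log x` lies above its tangent lines. -/
theorem mul_log_tangent_le {x y : ℝ} (hx : 0 < x) (hy : 0 < y) :
    (y - x) * (Real.log x + 1) ≤ y * Real.log y - x * Real.log x := by
  have h := Real.log_le_sub_one_of_pos (div_pos hx hy)
  rw [Real.log_div hx.ne' hy.ne'] at h
  have h2 := mul_le_mul_of_nonneg_left h hy.le
  have h3 : y * (x / y - 1) = x - y := by field_simp
  nlinarith


open Real MeasureTheory Filter

theorem phi_increment_short_interval_bound
    (φ : ℝ → ℝ) (T₀ : ℝ)
    (hcont : ContinuousOn φ (Set.Ici T₀))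
    (hmono : StrictMonoOn φ (Set.Ici T₀))
    (hpos : ∀ T ≥ T₀, 0 < φ T)
    (hladder : ∃ c₀ C : ℝ, ∀ T ≥ T₀,
      |(∫ t in (0:ℝ)..T, Z2 t) - (φ T / 2) * Real.log (φ T / 2)
        - (Real.eulerMascheroniConstant - Real.log (2 * Real.pi)) * (φ T / 2) - c₀|
        ≤ C * Real.log T / T)
    (k₁ k₂ : ℝ) (hk₁ : 0 < k₁) (hk₁₂ : k₁ ≤ k₂)
    (hgrowth : ∀ T ≥ T₀, k₁ * T ≤ φ T ∧ φ T ≤ k₂ * T)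
    (hBal : ∀ ε > (0:ℝ), ∃ C T₁ : ℝ, ∀ T ≥ T₁,
      |(∫ t in (0:ℝ)..T, Z2 t) - T * Real.log T
        - (2 * Real.eulerMascheroniConstant - 1 - Real.log (2 * Real.pi)) * T|
        ≤ C * T ^ ((1:ℝ)/3 + ε))
    (ε : ℝ) (hε : 0 < ε) :
    ∃ C T₁ : ℝ, ∀ T ≥ T₁, ∀ U : ℝ, 0 < U → U ≤ T ^ ((1:ℝ)/3 + 2*ε) →
      φ (T + U) - φ T ≤ φ (T + T ^ ((1:ℝ)/3 + 2*ε)) - φ T ∧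
      φ (T + T ^ ((1:ℝ)/3 + 2*ε)) - φ T ≤ C * T ^ ((1:ℝ)/3 + 2*ε) := by
  obtain ⟨c₀, C, hC⟩ := hladder
  obtain ⟨D, T₂, hD⟩ := hBal ε hε
  set d := Real.eulerMascheroniConstant - Real.log (2 * Real.pi)
  set b := 2 * Real.eulerMascheroniConstant - 1 - Real.log (2 * Real.pi)
  set β := (1:ℝ)/3 + 2*ε with hβ
  set α := (1:ℝ)/3 + ε with hα
  have hk₂ : 0 < k₂ := hk₁.trans_le hk₁₂
  set A := Real.log (k₁ / 2) + 1 + d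
  set B := Real.log 2 + 1 + b + (|D| * 2 ^ α + |D|) + 2 * |C| with hB
  obtain ⟨T₃, hT₃⟩ := eventually_atTop.1 (tendsto_log_atTop.eventually_ge_atTop
    (1 + 2 * |A| + |B|))
  refine ⟨8 + 2 * k₂, max (max T₀ T₂) (max T₃ 1), fun T hT U hU hUle => ?_⟩
  simp only [max_le_iff, ge_iff_le] at hT
  obtain ⟨⟨hT0, hT2⟩, hT3, hT1⟩ := hT
  have hTpos : 0 < T := by linarith
  have hβpos : 0 < β := by positivity
  have hU₀ : 1 ≤ T ^ β := Real.one_le_rpow hT1 hβpos.le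
  have hαβ : T ^ α ≤ T ^ β := Real.rpow_le_rpow_of_exponent_le hT1 (by linarith)
  set U₀ := T ^ β
  refine ⟨?_, ?_⟩
  · have := hmono.monotoneOn (Set.mem_Ici.2 (by linarith : T₀ ≤ T + U))
      (Set.mem_Ici.2 (by linarith : T₀ ≤ T + U₀)) (by linarith)
    linarith
  have hφT := hpos T hT0
  rcases le_total 1 β with h1β | hβ1
  · have hTU : T ≤ U₀ := by
      simpa using Real.rpow_le_rpow_of_exponent_le hT1 h1β
    have h1 := (hgrowth (T + U₀) (by linarith)).2
    nlinarith
  have hUT : U₀ ≤ T := by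
    simpa using Real.rpow_le_rpow_of_exponent_le hT1 hβ1
  have hV0 : T₀ ≤ T + U₀ := by linarith
  have hφV := hpos _ hV0
  have hlogT := hT₃ T hT3
  have hlad : ∀ S, 1 ≤ S → C * Real.log S / S ≤ |C| := fun S hS => by
    have hS0 : 0 < S := by linarith
    rw [div_le_iff₀ hS0]
    have h1 : Real.log S ≤ S := by linarith [Real.log_le_sub_one_of_pos hS0]
    exact mul_le_mul (le_abs_self C) h1 (Real.log_nonneg hS) (abs_nonneg C)
  have l1 := abs_le.1 ((hC T hT0).trans (hlad T hT1))
  have l2 := abs_le.1 ((hC (T + U₀) hV0).trans (hlad (T + U₀) (by linarith)))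
  have b1 := abs_le.1 (hD T hT2)
  have b2 := abs_le.1 (hD (T + U₀) (by linarith))
  have e1 : D * T ^ α ≤ |D| * U₀ :=
    mul_le_mul (le_abs_self D) hαβ (by positivity) (abs_nonneg D)
  have e2 : D * (T + U₀) ^ α ≤ |D| * 2 ^ α * U₀ := by
    have h1 : (T + U₀) ^ α ≤ 2 ^ α * T ^ α := by
      rw [← Real.mul_rpow (by norm_num) hTpos.le]
      exact Real.rpow_le_rpow (by linarith) (by linarith) (by positivity)
    have h2 : (2:ℝ) ^ α * T ^ α ≤ 2 ^ α * U₀ := by gcongr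
    rw [mul_assoc]
    exact mul_le_mul (le_abs_self D) (h1.trans h2) (by positivity) (abs_nonneg D)
  have t1 := mul_log_tangent_le (half_pos hφT) (half_pos hφV)
  have t2 := mul_log_tangent_le (by linarith : 0 < T + U₀) hTpos
  have g1 : Real.log (k₁ / 2) + Real.log T ≤ Real.log (φ T / 2) := by
    rw [← Real.log_mul (by positivity) hTpos.ne']
    exact Real.log_le_log (by positivity) (by linarith [(hgrowth T hT0).1])
  have g2 : Real.log (T + U₀) ≤ Real.log 2 + Real.log T := by
    rw [← Real.log_mul (by norm_num) hTpos.ne']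
    exact Real.log_le_log (by linarith) (by linarith)
  have hφle : φ T ≤ φ (T + U₀) := hmono.monotoneOn hT0 hV0 (by linarith)
  have lower : (φ (T + U₀) / 2 - φ T / 2) * (Real.log T + A) ≤
      (φ (T + U₀) / 2 - φ T / 2) * (Real.log (φ T / 2) + 1 + d) :=
    mul_le_mul_of_nonneg_left (by linarith) (by linarith)
  have upper : U₀ * Real.log (T + U₀) ≤ U₀ * (Real.log 2 + Real.log T) :=
    mul_le_mul_of_nonneg_left g2 (by linarith)
  have e3 : |C| ≤ |C| * U₀ := le_mul_of_one_le_right (abs_nonneg C) hU₀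
  have key : (φ (T + U₀) / 2 - φ T / 2) * (Real.log T + A) ≤ U₀ * (Real.log T + B) := by
    rw [hB]
    linarith
  have hA := neg_abs_le A
  have hB' := le_abs_self B
  have hA0 := abs_nonneg A
  have hB0 := abs_nonneg B
  have k1 : (φ (T + U₀) / 2 - φ T / 2) * (Real.log T / 2) ≤
      (φ (T + U₀) / 2 - φ T / 2) * (Real.log T + A) :=
    mul_le_mul_of_nonneg_left (by linarith) (by linarith)
  have k2 : U₀ * (Real.log T + B) ≤ U₀ * (2 * Real.log T) :=
    mul_le_mul_of_nonneg_left (by linarith) (by linarith)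
  have k3 : φ (T + U₀) - φ T ≤ 8 * U₀ :=
    le_of_mul_le_mul_right (by linarith) (by linarith : 0 < Real.log T)
  have k4 : 0 ≤ k₂ * U₀ := by positivity
  linarith
end
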